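/- Let f and g be linearly independent homogeneous polynomials of degree d in ℂ[x,y,z], spanning a pencil P, and let (a_x, a_y, a_z) be a normalized weight triple. Then for any nonzero member f' of P there exists a member h of P, not proportional to f', such that ω(P) = ω(f') + ω(h), where ω(P) is computed from the minors of the generators f and g. -/

import Mathlib

/-- The coefficient `f_{ij}` of the monomial `x^i y^j z^(d-i-j)` in a polynomial
`f ∈ ℂ[x,y,z]`, regarded as a plane curve of degree `d`. -/
noncomputable def coeffIJ (d : ℕ) (f : MvPolynomial (Fin 3) ℂ) (i j : ℕ) : ℂ :=
  MvPolynomial.coeff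
    (Finsupp.single (0 : Fin 3) i + Finsupp.single (1 : Fin 3) j +
      Finsupp.single (2 : Fin 3) (d - i - j)) f

/-- A normalized weight triple `(ax, ay, az)`:
`ax ≥ ay ≥ az`, `ax > 0` and `ax + ay + az = 0`. -/
def NormTriple (ax ay az : ℤ) : Prop :=
  ay ≤ ax ∧ az ≤ ay ∧ 0 < ax ∧ ax + ay + az = 0

/-- The affine weight `ω(f) = min {(ax-az)·i + (ay-az)·j : f_{ij} ≠ 0}` of a plane
curve of degree `d` at a normalized weight triple. -/
noncomputable def curveWeight (ax ay az : ℤ) (d : ℕ) (f : MvPolynomial (Fin 3) ℂ) : ℤ :=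
  sInf {w : ℤ | ∃ i j : ℕ, coeffIJ d f i j ≠ 0 ∧
    w = (ax - az) * (i : ℤ) + (ay - az) * (j : ℤ)}

/-- The Plücker coordinate (2×2 minor) `m_{ijkl} = f_{ij} g_{kl} - g_{ij} f_{kl}`
of the pencil spanned by `f` and `g`. -/
noncomputable def minor (d : ℕ) (f g : MvPolynomial (Fin 3) ℂ) (i j k l : ℕ) : ℂ :=
  coeffIJ d f i j * coeffIJ d g k l - coeffIJ d g i j * coeffIJ d f k l

/-- The affine weight `ω(P) = min {(ax-az)(i+k) + (ay-az)(j+l) : m_{ijkl} ≠ 0}` of the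
pencil spanned by `f` and `g` at a normalized weight triple. -/
noncomputable def pencilWeight (ax ay az : ℤ) (d : ℕ) (f g : MvPolynomial (Fin 3) ℂ) : ℤ :=
  sInf {w : ℤ | ∃ i j k l : ℕ, minor d f g i j k l ≠ 0 ∧
    w = (ax - az) * ((i : ℤ) + (k : ℤ)) + (ay - az) * ((j : ℤ) + (l : ℤ))}

theorem exists_coeffIJ_ne_zero {d : ℕ} {f : MvPolynomial (Fin 3) ℂ}
    (hf : f.IsHomogeneous d) (hf0 : f ≠ 0) : ∃ i j, coeffIJ d f i j ≠ 0 := by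
  obtain ⟨m, hm⟩ := MvPolynomial.ne_zero_iff.mp hf0
  have hdeg : m 0 + m 1 + m 2 = d := by
    have h := hf hm
    rw [Finsupp.weight_apply, Finsupp.sum_fintype _ _ (by simp)] at h
    simpa [Fin.sum_univ_three] using h
  refine ⟨m 0, m 1, ?_⟩
  have key : Finsupp.single (0 : Fin 3) (m 0) + Finsupp.single (1 : Fin 3) (m 1) +
      Finsupp.single (2 : Fin 3) (d - m 0 - m 1) = m := by
    ext k
    fin_cases k
    · simp
    · simp
    · simp
      omega
  rwa [coeffIJ, key]

/-- The affine weight of a nonzero curve is attained. -/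
theorem isLeast_curveWeight {ax ay az : ℤ} (hnorm : NormTriple ax ay az) {d : ℕ}
    {f : MvPolynomial (Fin 3) ℂ} (hf : f.IsHomogeneous d) (hf0 : f ≠ 0) :
    IsLeast {w : ℤ | ∃ i j : ℕ, coeffIJ d f i j ≠ 0 ∧
      w = (ax - az) * (i : ℤ) + (ay - az) * (j : ℤ)} (curveWeight ax ay az d f) := by
  obtain ⟨hxy, hyz, -, -⟩ := hnorm
  have hbdd : BddBelow {w : ℤ | ∃ i j : ℕ, coeffIJ d f i j ≠ 0 ∧
      w = (ax - az) * (i : ℤ) + (ay - az) * (j : ℤ)} := by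
    refine ⟨0, ?_⟩
    rintro w ⟨i, j, -, rfl⟩
    have hx : 0 ≤ ax - az := by linarith
    have hy : 0 ≤ ay - az := by linarith
    positivity
  obtain ⟨i, j, hij⟩ := exists_coeffIJ_ne_zero hf hf0
  exact ⟨Int.csInf_mem ⟨_, i, j, hij, rfl⟩ hbdd, fun w hw => csInf_le hbdd hw⟩

theorem coeffIJ_smul_add_smul (d : ℕ) (f g : MvPolynomial (Fin 3) ℂ) (a b : ℂ) (i j : ℕ) :
    coeffIJ d (a • f + b • g) i j = a * coeffIJ d f i j + b * coeffIJ d g i j := by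
  simp [coeffIJ]

theorem minor_smul_add_smul (d : ℕ) (f g : MvPolynomial (Fin 3) ℂ) (a b a' b' : ℂ)
    (i j k l : ℕ) :
    minor d (a • f + b • g) (a' • f + b' • g) i j k l =
      (a * b' - b * a') * minor d f g i j k l := by
  simp only [minor, coeffIJ_smul_add_smul]
  ring

/-- The affine weight of a pencil may be computed from any two generators. -/
theorem pencilWeight_smul_add_smul (ax ay az : ℤ) (d : ℕ) (f g : MvPolynomial (Fin 3) ℂ)
    {a b a' b' : ℂ} (hdet : a * b' - b * a' ≠ 0) :
    pencilWeight ax ay az d (a • f + b • g) (a' • f + b' • g) = pencilWeight ax ay az d f g := by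
  simp only [pencilWeight, minor_smul_add_smul, mul_ne_zero_iff, hdet, ne_eq, not_false_eq_true,
    true_and]

/-- If the weight of `f` is attained at a monomial that does not occur in `h`, then the weight
of the pencil spanned by `f` and `h` is the sum of their weights. -/
theorem pencilWeight_eq_add {ax ay az : ℤ} (hnorm : NormTriple ax ay az) {d : ℕ}
    {f h : MvPolynomial (Fin 3) ℂ} (hh : h.IsHomogeneous d) (hh0 : h ≠ 0)
    (hf : f.IsHomogeneous d) {i j : ℕ} (hfij : coeffIJ d f i j ≠ 0)
    (hw : curveWeight ax ay az d f = (ax - az) * (i : ℤ) + (ay - az) * (j : ℤ))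
    (hhij : coeffIJ d h i j = 0) :
    pencilWeight ax ay az d f h = curveWeight ax ay az d f + curveWeight ax ay az d h := by
  have hf0 : f ≠ 0 := by
    rintro rfl
    simp [coeffIJ] at hfij
  have lf := (isLeast_curveWeight hnorm hf hf0).2
  obtain ⟨⟨k, l, hkl, hwh⟩, lh⟩ := isLeast_curveWeight hnorm hh hh0
  refine IsLeast.csInf_eq ⟨⟨i, j, k, l, ?_, ?_⟩, ?_⟩
  · simp [minor, hhij, hfij, hkl]
  · rw [hw, hwh]
    ring
  · rintro w ⟨p, q, r, s, hm, rfl⟩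
    by_cases hpq : coeffIJ d f p q * coeffIJ d h r s = 0
    · have hrs : coeffIJ d h p q * coeffIJ d f r s ≠ 0 := by
        intro h0
        exact hm (by rw [minor, hpq, h0, sub_zero])
      have h1 := lh ⟨p, q, left_ne_zero_of_mul hrs, rfl⟩
      have h2 := lf ⟨r, s, right_ne_zero_of_mul hrs, rfl⟩
      linarith
    · have h1 := lf ⟨p, q, left_ne_zero_of_mul hpq, rfl⟩
      have h2 := lh ⟨r, s, right_ne_zero_of_mul hpq, rfl⟩
      linarith

/-- For any nonzero member `f'` of the pencil spanned by `f` and `g`,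
there is a member `h` of the pencil, not proportional to `f'`, with
`ω(P) = ω(f') + ω(h)`. -/
theorem exists_member_pencilWeight_eq_add
    (d : ℕ) (hd : 1 ≤ d) (f g : MvPolynomial (Fin 3) ℂ)
    (hf : f.IsHomogeneous d) (hg : g.IsHomogeneous d)
    (hind : LinearIndependent ℂ ![f, g])
    (ax ay az : ℤ) (hnorm : NormTriple ax ay az)
    (f' : MvPolynomial (Fin 3) ℂ)
    (hf'mem : f' ∈ Submodule.span ℂ ({f, g} : Set (MvPolynomial (Fin 3) ℂ)))
    (hf'0 : f' ≠ 0) :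
    ∃ h ∈ Submodule.span ℂ ({f, g} : Set (MvPolynomial (Fin 3) ℂ)),
      (¬ ∃ c : ℂ, h = c • f') ∧
      pencilWeight ax ay az d f g = curveWeight ax ay az d f' + curveWeight ax ay az d h := by
  obtain ⟨a, b, rfl⟩ := Submodule.mem_span_pair.mp hf'mem
  have homog (s t : ℂ) : (s • f + t • g).IsHomogeneous d :=
    (MvPolynomial.homogeneousSubmodule (Fin 3) ℂ d).add_mem
      (Submodule.smul_mem _ s hf) (Submodule.smul_mem _ t hg)
  obtain ⟨i, j, hij, hw⟩ := (isLeast_curveWeight hnorm (homog a b) hf'0).1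
  have hdet : a * coeffIJ d f i j - b * -coeffIJ d g i j ≠ 0 := by
    rw [coeffIJ_smul_add_smul] at hij
    rwa [mul_neg, sub_neg_eq_add]
  have hh0 : (-coeffIJ d g i j) • f + coeffIJ d f i j • g ≠ 0 := by
    intro h0
    obtain ⟨h1, h2⟩ := LinearIndependent.pair_iff.mp hind _ _ h0
    exact hdet (by rw [h1, h2]; ring)
  have hhij : coeffIJ d ((-coeffIJ d g i j) • f + coeffIJ d f i j • g) i j = 0 := by
    rw [coeffIJ_smul_add_smul]
    ring
  refine ⟨_, Submodule.mem_span_pair.mpr ⟨-coeffIJ d g i j, coeffIJ d f i j, rfl⟩, ?_, ?_⟩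
  · rintro ⟨c, hc⟩
    have hcij : c * coeffIJ d (a • f + b • g) i j = 0 := by
      rw [← hhij, hc, coeffIJ, coeffIJ, MvPolynomial.coeff_smul, smul_eq_mul]
    rw [(mul_eq_zero.mp hcij).resolve_right hij, zero_smul] at hc
    exact hh0 hc
  · rw [← pencilWeight_smul_add_smul ax ay az d f g hdet]
    exact pencilWeight_eq_add hnorm (homog _ _) hh0 (homog a b) hij hw hhij
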